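/- Let f : G → G be a graph map and x ∈ G. Then the following are equivalent: (1) ω_f(x) is a solenoid for f; (2) for every m ∈ ℕ, the ω-limit set ω_{f^m}(x) of x under f^m is a solenoid for f^m; (3) there exists some m ∈ ℕ such that ω_{f^m}(x) is a solenoid for f^m. -/

import Mathlib

open Set Filter Topology

/-- An arc in `X` with endpoints `a` and `b`: the image of a continuous injection
of `[0,1]` sending `0` to `a` and `1` to `b`. -/
def IsArcWithEnds {X : Type*} [TopologicalSpace X] (A : Set X) (a b : X) : Prop :=
  ∃ φ : Set.Icc (0:ℝ) 1 → X, Continuous φ ∧ Function.Injective φ ∧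
    Set.range φ = A ∧ φ ⟨0, by norm_num⟩ = a ∧ φ ⟨1, by norm_num⟩ = b

/-- A topological graph: a compact connected (metrizable) space which is a union of
finitely many arcs, any two of which are either disjoint or intersect in exactly one
common endpoint. -/
def IsTopGraph (X : Type*) [TopologicalSpace X] : Prop :=
  CompactSpace X ∧ ConnectedSpace X ∧
  ∃ (n : ℕ) (A : Fin n → Set X) (a b : Fin n → X),
    (∀ i, IsArcWithEnds (A i) (a i) (b i)) ∧
    (⋃ i, A i) = Set.univ ∧
    ∀ i j, i ≠ j →
      A i ∩ A j = ∅ ∨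
      ∃ p, A i ∩ A j = {p} ∧ p ∈ ({a i, b i} : Set X) ∧ p ∈ ({a j, b j} : Set X)

/-- A subgraph of `G`: a closed connected subset which is itself a topological graph. -/
def IsSubgraph {G : Type*} [TopologicalSpace G] (K : Set G) : Prop :=
  IsClosed K ∧ IsConnected K ∧ IsTopGraph ↥K

/-- A periodic subgraph with period `k`: `K, f(K), …, f^{k−1}(K)` are pairwise disjoint
and `f^k(K) = K`. -/
def IsPeriodicSubgraph {G : Type*} [TopologicalSpace G] (f : G → G) (K : Set G) (k : ℕ) :
    Prop :=
  IsSubgraph K ∧ 0 < k ∧ f^[k] '' K = K ∧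
    ∀ i j, i < k → j < k → i ≠ j → Disjoint (f^[i] '' K) (f^[j] '' K)

/-- A cycle of graphs with period `k`: the orbit `⋃_{i<k} f^i(K)` of a periodic
subgraph `K` with period `k`. -/
def IsCycleOfGraphs {G : Type*} [TopologicalSpace G] (f : G → G) (X : Set G) (k : ℕ) :
    Prop :=
  ∃ K, IsPeriodicSubgraph f K k ∧ X = ⋃ i ∈ Finset.range k, f^[i] '' K

/-- The ω-limit set of `x` under `f`. -/
def omegaSet {G : Type*} [TopologicalSpace G] (f : G → G) (x : G) : Set G :=
  ⋂ n : ℕ, closure ((fun m => f^[m] x) '' Set.Ici n)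

/-- `ω(f) = ⋃_{x} ω_f(x)`. -/
def omegaUnion {G : Type*} [TopologicalSpace G] (f : G → G) : Set G :=
  ⋃ x, omegaSet f x

/-- A set `W` is a solenoid for `f` if it is infinite and is contained in cycles of
graphs of arbitrarily large periods. -/
def IsSolenoid {G : Type*} [TopologicalSpace G] (f : G → G) (W : Set G) : Prop :=
  W.Infinite ∧ ∀ n : ℕ, ∃ X k, n ≤ k ∧ IsCycleOfGraphs f X k ∧ W ⊆ X

/-- Two points are separable if they belong to two disjoint periodic subgraphs. -/
def SeparablePoints {G : Type*} [TopologicalSpace G] (f : G → G) (x y : G) : Prop :=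
  ∃ I J kI kJ, IsPeriodicSubgraph f I kI ∧ IsPeriodicSubgraph f J kJ ∧
    Disjoint I J ∧ x ∈ I ∧ y ∈ J

/-- An NS-pair: a pair of distinct points of `ω(f)` contained in a nested sequence of
periodic subgraphs whose periods tend to infinity. -/
def IsNSPair {G : Type*} [TopologicalSpace G] (f : G → G) (x y : G) : Prop :=
  x ≠ y ∧ x ∈ omegaUnion f ∧ y ∈ omegaUnion f ∧
  ∃ (J : ℕ → Set G) (m : ℕ → ℕ),
    (∀ n, IsPeriodicSubgraph f (J n) (m n)) ∧
    (∀ n, J (n + 1) ⊆ J n) ∧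
    Filter.Tendsto m Filter.atTop Filter.atTop ∧
    ∀ n, x ∈ J n ∧ y ∈ J n

/-- The pair `⟨x,y⟩` is proximal. -/
def Proximal {G : Type*} [PseudoMetricSpace G] (f : G → G) (x y : G) : Prop :=
  ∀ ε > (0 : ℝ), ∀ N : ℕ, ∃ n ≥ N, dist (f^[n] x) (f^[n] y) < ε

/-- The pair `⟨x,y⟩` is asymptotic. -/
def Asymptotic {G : Type*} [PseudoMetricSpace G] (f : G → G) (x y : G) : Prop :=
  Filter.Tendsto (fun n => dist (f^[n] x) (f^[n] y)) Filter.atTop (nhds 0)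

/-- A scrambled pair is proximal but not asymptotic. -/
def ScrambledPair {G : Type*} [PseudoMetricSpace G] (f : G → G) (x y : G) : Prop :=
  Proximal f x y ∧ ¬ Asymptotic f x y

/-- Li–Yorke chaos: existence of an uncountable scrambled set. -/
def LiYorkeChaotic {G : Type*} [PseudoMetricSpace G] (f : G → G) : Prop :=
  ∃ S : Set G, ¬ S.Countable ∧ ∀ x ∈ S, ∀ y ∈ S, x ≠ y → ScrambledPair f x y

/-- `I ⊆ ℕ` is an independence set for the pair of sets `{A, B}`. -/
def IsIndepSet {G : Type*} (f : G → G) (A B : Set G) (I : Set ℕ) : Prop :=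
  ∀ J : Finset ℕ, ↑J ⊆ I → J.Nonempty → ∀ S : ℕ → Bool,
    (⋂ i ∈ J, f^[i] ⁻¹' (if S i then A else B)).Nonempty

/-- An IN-pair: every pair of neighborhoods has arbitrarily large finite
independence sets. -/
def IsINPair {G : Type*} [TopologicalSpace G] (f : G → G) (x y : G) : Prop :=
  ∀ U V : Set G, U ∈ nhds x → V ∈ nhds y →
    ∀ n : ℕ, ∃ I : Finset ℕ, n ≤ I.card ∧ IsIndepSet f U V ↑I

/-- An IT-pair: every pair of neighborhoods has an infinite independence set. -/
def IsITPair {G : Type*} [TopologicalSpace G] (f : G → G) (x y : G) : Prop :=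
  ∀ U V : Set G, U ∈ nhds x → V ∈ nhds y →
    ∃ I : Set ℕ, I.Infinite ∧ IsIndepSet f U V I

/-- The set of periodic points of `f`. -/
def PerPts {G : Type*} (f : G → G) : Set G :=
  {p | ∃ n ≥ 1, f^[n] p = p}

section Graph

open unitInterval

/-- A family of parametrized arcs any two of which meet in at most one point, which is then
an endpoint of both. -/
structure IsArcFamily {ι X : Type*} [TopologicalSpace X] (φ : ι → I → X) : Prop where
  continuous : ∀ i, Continuous (φ i)
  injective : ∀ i, Function.Injective (φ i)
  endpoints : ∀ i j s t, i ≠ j → φ i s = φ j t → (s = 0 ∨ s = 1) ∧ (t = 0 ∨ t = 1)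
  subsingleton : ∀ i j, i ≠ j → (range (φ i) ∩ range (φ j)).Subsingleton

theorem IsTopGraph.exists_isArcFamily {X : Type*} [TopologicalSpace X] (h : IsTopGraph X) :
    ∃ (n : ℕ) (φ : Fin n → I → X), IsArcFamily φ ∧ (⋃ i, range (φ i)) = univ := by
  obtain ⟨-, -, n, A, a, b, hA, hU, hI⟩ := h
  choose φ hc hi hr h0 h1 using hA
  have key : ∀ i s, (φ i s = a i ∨ φ i s = b i) → (s = 0 ∨ s = 1) := by
    rintro i s (h | h)
    · exact Or.inl (hi i (h.trans (h0 i).symm))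
    · exact Or.inr (hi i (h.trans (h1 i).symm))
  refine ⟨n, φ, ⟨hc, hi, ?_, ?_⟩, by simpa only [hr] using hU⟩
  · intro i j s t hij hst
    have hmem : φ i s ∈ A i ∩ A j := ⟨hr i ▸ mem_range_self s, hst ▸ hr j ▸ mem_range_self t⟩
    rcases hI i j hij with h | ⟨p, hp, hpi, hpj⟩
    · simp [h] at hmem
    · rw [hp, mem_singleton_iff] at hmem
      subst hmem
      exact ⟨key i s hpi, key j t (hst ▸ hpj)⟩
  · intro i j hij
    rw [hr, hr]
    rcases hI i j hij with h | ⟨p, hp, -, -⟩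
    · simp [h]
    · simp [hp]

theorem IsArcFamily.isTopGraph {ι X : Type*} [Finite ι] [TopologicalSpace X] {φ : ι → I → X}
    (hφ : IsArcFamily φ) {C : Set X} (hC : IsConnected C) (hU : (⋃ i, range (φ i)) = C) :
    IsTopGraph C := by
  obtain ⟨n, ⟨e⟩⟩ := Finite.exists_equiv_fin ι
  have hmem : ∀ i s, φ i s ∈ C := fun i s => hU ▸ mem_iUnion.2 ⟨i, mem_range_self s⟩
  refine ⟨?_, isConnected_iff_connectedSpace.1 hC, n,
    fun k => range (fun s => (⟨φ (e.symm k) s, hmem _ s⟩ : C)),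
    fun k => ⟨φ (e.symm k) 0, hmem _ _⟩, fun k => ⟨φ (e.symm k) 1, hmem _ _⟩, ?_, ?_, ?_⟩
  · rw [← isCompact_iff_compactSpace, ← hU]
    exact isCompact_iUnion fun i => isCompact_range (hφ.continuous i)
  · intro k
    refine ⟨_, (hφ.continuous (e.symm k)).subtype_mk _, ?_, rfl, rfl, rfl⟩
    intro s t hst
    exact hφ.injective _ (congrArg Subtype.val hst)
  · refine eq_univ_of_forall fun ⟨c, hc⟩ => ?_
    rw [← hU, mem_iUnion] at hc
    obtain ⟨i, s, rfl⟩ := hc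
    exact mem_iUnion.2 ⟨e i, s, by simp⟩
  · intro i j hij
    have hij' : e.symm i ≠ e.symm j := e.symm.injective.ne hij
    rcases eq_empty_or_nonempty (range (fun s => (⟨φ (e.symm i) s, hmem _ s⟩ : C)) ∩
      range (fun s => (⟨φ (e.symm j) s, hmem _ s⟩ : C))) with h | ⟨p, ⟨s, hs⟩, ⟨t, ht⟩⟩
    · exact Or.inl h
    · have hst : φ (e.symm i) s = φ (e.symm j) t := congrArg Subtype.val (hs.trans ht.symm)
      obtain ⟨h1, h2⟩ := hφ.endpoints _ _ s t hij' hst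
      refine Or.inr ⟨p, Subset.antisymm ?_ ?_, ?_, ?_⟩
      · rintro q ⟨⟨s', hs'⟩, ⟨t', ht'⟩⟩
        refine Subtype.ext (hφ.subsingleton _ _ hij' ?_ ?_)
        · exact ⟨⟨s', congrArg Subtype.val hs'⟩, ⟨t', congrArg Subtype.val ht'⟩⟩
        · exact ⟨⟨s, congrArg Subtype.val hs⟩, ⟨t, congrArg Subtype.val ht⟩⟩
      · rintro q rfl
        exact ⟨⟨s, hs⟩, ⟨t, ht⟩⟩
      · rcases h1 with rfl | rfl
        · exact Or.inl hs.symm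
        · exact Or.inr hs.symm
      · rcases h2 with rfl | rfl
        · exact Or.inl ht.symm
        · exact Or.inr ht.symm

/-- A connected set that meets an open subarc but not its endpoints lies in the subarc. -/
theorem IsArcFamily.subset_image_Ioo {ι X : Type*} [Finite ι] [TopologicalSpace X] [T2Space X]
    {φ : ι → I → X} (hφ : IsArcFamily φ) (hU : (⋃ i, range (φ i)) = univ) {Z : Set X}
    (hZ : IsPreconnected Z) {i : ι} {v u w : I} (hvu : v < u) (huw : u < w)
    (hv : φ i v ∉ Z) (hu : φ i u ∈ Z) (hw : φ i w ∉ Z) : Z ⊆ φ i '' Ioo v w := by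
  have hopen : IsOpen (φ i '' Ioo v w) := by
    have hcl : IsClosed ((⋃ j : {j // j ≠ i}, range (φ j)) ∪ φ i '' (Ioo v w)ᶜ) := by
      refine IsClosed.union (isClosed_iUnion_of_finite fun j => ?_) ?_
      · exact (isCompact_range (hφ.continuous j)).isClosed
      · exact (isOpen_Ioo.isClosed_compl.isCompact.image (hφ.continuous i)).isClosed
    convert hcl.isOpen_compl using 1
    ext y
    constructor
    · rintro ⟨s, hs, rfl⟩ (h | ⟨t, ht, hts⟩)
      · obtain ⟨⟨j, hj⟩, t, ht⟩ := mem_iUnion.1 h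
        rcases (hφ.endpoints j i t s hj ht).2 with rfl | rfl
        · exact absurd hs.1 (not_lt.2 unitInterval.nonneg')
        · exact absurd hs.2 (not_lt.2 unitInterval.le_one')
      · exact ht (hφ.injective i hts ▸ hs)
    · intro hy
      have hyU : y ∈ ⋃ i, range (φ i) := hU ▸ mem_univ y
      obtain ⟨j, s, rfl⟩ := mem_iUnion.1 hyU
      by_cases hj : j = i
      · subst hj
        by_contra h
        exact hy (Or.inr ⟨s, fun hs => h ⟨s, hs, rfl⟩, rfl⟩)
      · exact (hy (Or.inl (mem_iUnion.2 ⟨⟨j, hj⟩, s, rfl⟩))).elim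
  have hcl : IsClosed (φ i '' Icc v w) :=
    (isCompact_Icc.image (hφ.continuous i)).isClosed
  refine hZ.subset_left_of_subset_union hopen hcl.isOpen_compl ?_ ?_ ⟨_, hu, u, ⟨hvu, huw⟩, rfl⟩
  · exact disjoint_compl_right.mono_left (image_mono Ioo_subset_Icc_self)
  · intro z hz
    by_cases h : z ∈ φ i '' Icc v w
    · obtain ⟨s, hs, rfl⟩ := h
      refine Or.inl ⟨s, ⟨lt_of_le_of_ne hs.1 ?_, lt_of_le_of_ne hs.2 ?_⟩, rfl⟩
      · rintro rfl; exact hv hz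
      · rintro rfl; exact hw hz
    · exact Or.inr h

theorem isClosed_connectedComponentIn {X : Type*} [TopologicalSpace X] {F : Set X}
    (hF : IsClosed F) (x : X) : IsClosed (connectedComponentIn F x) := by
  by_cases hx : x ∈ F
  · refine isClosed_of_closure_subset ?_
    exact isPreconnected_connectedComponentIn.closure.subset_connectedComponentIn
      (subset_closure (mem_connectedComponentIn hx))
      (hF.closure_subset_iff.2 (connectedComponentIn_subset F x))
  · simp [connectedComponentIn_eq_empty hx]

theorem exists_parametrization {Q : Set I} (hQ : IsClosed Q) (hc : IsPreconnected Q)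
    (hn : Q.Nontrivial) : ∃ κ : I → I, Continuous κ ∧ Function.Injective κ ∧ range κ = Q ∧
      (∀ a, κ a = 0 → a = 0) ∧ ∀ a, κ a = 1 → a = 1 := by
  obtain ⟨s, t, hQst⟩ : ∃ s t, Q = Icc s t :=
    ⟨_, _, eq_Icc_of_connected_compact (And.intro hn.nonempty hc) hQ.isCompact⟩
  have hst : s < t := by
    obtain ⟨x, hx, y, hy, hxy⟩ := hn
    rw [hQst] at hx hy
    rcases lt_or_gt_of_ne hxy with h | h
    · exact hx.1.trans_lt (h.trans_le hy.2)
    · exact hy.1.trans_lt (h.trans_le hx.2)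
  have hst' : (s : ℝ) < t := hst
  have hs0 : (0 : ℝ) ≤ s := s.2.1
  have ht1 : (t : ℝ) ≤ 1 := t.2.2
  have hmem : ∀ a : I, (s : ℝ) + a * (t - s) ∈ Icc (0 : ℝ) 1 := by
    intro a
    have h0 := a.2.1
    have h1 := a.2.2
    constructor <;> nlinarith
  refine ⟨fun a => ⟨s + a * (t - s), hmem a⟩, by fun_prop, ?_, ?_, ?_, ?_⟩
  · intro a b hab
    have := congrArg Subtype.val hab
    simp only [add_right_inj, mul_eq_mul_right_iff, sub_eq_zero] at this
    exact Subtype.ext (this.resolve_right hst'.ne')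
  · rw [hQst]
    ext y
    constructor
    · rintro ⟨a, rfl⟩
      have h0 := a.2.1
      have h1 := a.2.2
      constructor <;> rw [← Subtype.coe_le_coe] <;> simp only <;> nlinarith
    · rintro ⟨h1, h2⟩
      rw [← Subtype.coe_le_coe] at h1 h2
      have hpos : (0 : ℝ) < t - s := by linarith
      refine ⟨⟨(y - s) / (t - s), div_nonneg (by linarith) hpos.le,
        (div_le_one hpos).2 (by linarith)⟩, Subtype.ext ?_⟩
      simp only
      field_simp
      ring
  · intro a ha
    have := congrArg Subtype.val ha
    simp only [Icc.coe_zero] at this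
    have h0 := a.2.1
    exact Subtype.ext (by simp only [Icc.coe_zero]; nlinarith)
  · intro a ha
    have := congrArg Subtype.val ha
    simp only [Icc.coe_one] at this
    have h1 := a.2.2
    exact Subtype.ext (by simp only [Icc.coe_one]; nlinarith)

/-- In a topological graph every nondegenerate subcontinuum is a topological graph. -/
theorem IsTopGraph.isSubgraph {X : Type*} [TopologicalSpace X] [T2Space X] (hX : IsTopGraph X)
    {C : Set X} (hcl : IsClosed C) (hC : IsConnected C) (hn : C.Nontrivial) : IsSubgraph C := by
  refine ⟨hcl, hC, ?_⟩
  obtain ⟨n, φ, hφ, hU⟩ := hX.exists_isArcFamily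
  have hT : ∀ i, IsClosed (φ i ⁻¹' C) := fun i => hcl.preimage (hφ.continuous i)
  have trichotomy : ∀ i, ∀ u ∈ φ i ⁻¹' C, 0 ∈ connectedComponentIn (φ i ⁻¹' C) u ∨
      1 ∈ connectedComponentIn (φ i ⁻¹' C) u ∨
      (connectedComponentIn (φ i ⁻¹' C) u = φ i ⁻¹' C ∧ C ⊆ range (φ i)) := by
    intro i u hu
    by_cases h0 : 0 ∈ connectedComponentIn (φ i ⁻¹' C) u
    · exact Or.inl h0
    by_cases h1 : 1 ∈ connectedComponentIn (φ i ⁻¹' C) u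
    · exact Or.inr (Or.inl h1)
    refine Or.inr (Or.inr ?_)
    obtain ⟨v, hvu, hv⟩ : ∃ v < u, v ∉ φ i ⁻¹' C := by
      by_contra! h
      refine h0 (isPreconnected_Icc.subset_connectedComponentIn (s := Icc 0 u)
        ⟨unitInterval.nonneg', le_rfl⟩ (fun y hy => ?_) ⟨le_rfl, unitInterval.nonneg'⟩)
      rcases hy.2.lt_or_eq with hlt | rfl
      exacts [h y hlt, hu]
    obtain ⟨w, huw, hw⟩ : ∃ w > u, w ∉ φ i ⁻¹' C := by
      by_contra! h
      refine h1 (isPreconnected_Icc.subset_connectedComponentIn (s := Icc u 1)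
        ⟨le_rfl, unitInterval.le_one'⟩ (fun y hy => ?_) ⟨unitInterval.le_one', le_rfl⟩)
      rcases hy.1.lt_or_eq with hlt | rfl
      exacts [h y hlt, hu]
    have hsub : C ⊆ range (φ i) :=
      (hφ.subset_image_Ioo hU hC.isPreconnected hvu huw hv hu hw).trans (image_subset_range _ _)
    refine ⟨Subset.antisymm (connectedComponentIn_subset _ _) ?_, hsub⟩
    refine IsPreconnected.subset_connectedComponentIn ?_ hu Subset.rfl
    have hind := ((hφ.continuous i).isClosedEmbedding (hφ.injective i)).isInducing
    rw [← hind.isPreconnected_image, image_preimage_eq_of_subset hsub]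
    exact hC.isPreconnected
  let P : Set (Fin n × Set I) := {p | p.2.Nontrivial ∧
    ∃ u ∈ φ p.1 ⁻¹' C, p.2 = connectedComponentIn (φ p.1 ⁻¹' C) u}
  have hPfin : P.Finite := by
    have : (⋃ i : Fin n, (fun Q => (i, Q)) '' {connectedComponentIn (φ i ⁻¹' C) 0,
        connectedComponentIn (φ i ⁻¹' C) 1, φ i ⁻¹' C}).Finite :=
      finite_iUnion fun i => (Set.toFinite _).image _
    refine this.subset ?_
    rintro ⟨i, Q⟩ ⟨-, u, hu, hQ⟩
    simp only at hu hQ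
    refine mem_iUnion.2 ⟨i, Q, ?_, rfl⟩
    rcases trichotomy i u hu with h | h | h
    · exact Or.inl (hQ.trans (connectedComponentIn_eq h))
    · exact Or.inr (Or.inl (hQ.trans (connectedComponentIn_eq h)))
    · exact Or.inr (Or.inr (hQ.trans h.1))
  have : Finite P := hPfin
  have hpar : ∀ p : P, ∃ κ : I → I, Continuous κ ∧ Function.Injective κ ∧ range κ = p.1.2 ∧
      (∀ a, κ a = 0 → a = 0) ∧ ∀ a, κ a = 1 → a = 1 := by
    rintro ⟨⟨i, Q⟩, hQn, u, hu, hQ⟩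
    simp only at hQn hu hQ ⊢
    subst hQ
    exact exists_parametrization (isClosed_connectedComponentIn (hT i) u)
      isPreconnected_connectedComponentIn hQn
  choose κ hκc hκi hκr hκ0 hκ1 using hpar
  have hκmem : ∀ p a, κ p a ∈ p.1.2 := fun p a => hκr p ▸ mem_range_self a
  have heq : ∀ p q : P, p.1.1 = q.1.1 → (p.1.2 ∩ q.1.2).Nonempty → p = q := by
    rintro ⟨⟨i, Q⟩, hQn, u, hu, hQ⟩ ⟨⟨j, R⟩, hRn, v, hv, hR⟩ hij ⟨y, hy1, hy2⟩
    obtain rfl : i = j := hij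
    simp only at hQ hR hy1 hy2
    rw [hQ] at hy1
    rw [hR] at hy2
    simp [hQ, hR, connectedComponentIn_eq hy1, connectedComponentIn_eq hy2]
  have hψ : IsArcFamily (fun (p : P) a => φ p.1.1 (κ p a)) := by
    refine ⟨fun p => (hφ.continuous _).comp (hκc p), fun p => (hφ.injective _).comp (hκi p), ?_, ?_⟩
    · intro p q a b hpq hab
      by_cases hi : p.1.1 = q.1.1
      · rw [hi] at hab
        exact absurd (heq p q hi ⟨_, hκmem p a, hφ.injective _ hab ▸ hκmem q b⟩) hpq
      · obtain ⟨h1, h2⟩ := hφ.endpoints _ _ _ _ hi hab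
        exact ⟨h1.imp (hκ0 p a) (hκ1 p a), h2.imp (hκ0 q b) (hκ1 q b)⟩
    · intro p q hpq
      by_cases hi : p.1.1 = q.1.1
      · rintro y ⟨⟨a, rfl⟩, ⟨b, hb⟩⟩
        simp only [← hi] at hb
        exact absurd (heq p q hi ⟨_, hκmem p a, hφ.injective _ hb ▸ hκmem q b⟩) hpq
      · refine (hφ.subsingleton _ _ hi).anti (inter_subset_inter ?_ ?_) <;>
        · rintro _ ⟨a, rfl⟩
          exact mem_range_self _
  refine hψ.isTopGraph hC (Subset.antisymm ?_ ?_)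
  · rintro _ hy
    obtain ⟨⟨⟨i, Q⟩, hQn, u, hu, hQ⟩, a, rfl⟩ := mem_iUnion.1 hy
    have h := hκmem ⟨⟨i, Q⟩, hQn, u, hu, hQ⟩ a
    simp only at hu hQ h ⊢
    exact connectedComponentIn_subset (φ i ⁻¹' C) u (hQ.subset h)
  · set F := ⋃ p : P, range (fun a => φ p.1.1 (κ p a))
    have hFcl : IsClosed F := isClosed_iUnion_of_finite fun p =>
      (isCompact_range (hψ.continuous p)).isClosed
    have hfin : (C \ F).Finite := by
      have : (⋃ i : Fin n, ({φ i 0, φ i 1} : Set X)).Finite :=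
        finite_iUnion fun i => Set.toFinite _
      refine this.subset ?_
      rintro y ⟨hyC, hyF⟩
      have hyU : y ∈ ⋃ i, range (φ i) := hU ▸ mem_univ y
      obtain ⟨i, u, rfl⟩ := mem_iUnion.1 hyU
      have hQu : u ∈ connectedComponentIn (φ i ⁻¹' C) u := mem_connectedComponentIn hyC
      have hsub : (connectedComponentIn (φ i ⁻¹' C) u).Subsingleton := by
        by_contra h
        rw [not_subsingleton_iff] at h
        let p : P := ⟨(i, connectedComponentIn (φ i ⁻¹' C) u), h, u, hyC, rfl⟩
        have : u ∈ range (κ p) := (hκr p).symm ▸ hQu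
        obtain ⟨a, ha⟩ := this
        exact hyF (mem_iUnion.2 ⟨p, a, congrArg (φ i) ha⟩)
      refine mem_iUnion.2 ⟨i, ?_⟩
      rcases trichotomy i u hyC with h | h | ⟨h, h'⟩
      · exact Or.inl (congrArg (φ i) (hsub hQu h))
      · exact Or.inr (congrArg (φ i) (hsub hQu h))
      · refine absurd hn (not_nontrivial_iff.2 ?_)
        rw [h] at hsub
        rw [← image_preimage_eq_of_subset h']
        exact hsub.image _
    intro y hyC
    by_contra hyF
    have hacc := hC.isPreconnected.preperfect_of_nontrivial hn y hyC
    have hinf := accPt_iff_frequently_nhdsNE.1 hacc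
    refine hinf ?_
    have h1 : ∀ᶠ z in 𝓝[≠] y, z ∉ F :=
      nhdsWithin_le_nhds (hFcl.isOpen_compl.mem_nhds hyF)
    have h2 : ∀ᶠ z in 𝓝[≠] y, z ∉ (C \ F) \ {y} :=
      nhdsWithin_le_nhds ((hfin.sdiff).isClosed.isOpen_compl.mem_nhds (by simp))
    filter_upwards [h1, h2, self_mem_nhdsWithin] with z hz1 hz2 hz3 hz
    exact hz2 ⟨⟨hz, hz1⟩, hz3⟩

/-- In a topological graph, some finite set meets all connected sets of diameter at least `ε`. -/
theorem IsTopGraph.exists_finite_separating {X : Type*} [MetricSpace X] (hX : IsTopGraph X)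
    {ε : ℝ} (hε : 0 < ε) : ∃ F : Finset X, ∀ Z : Set X, IsPreconnected Z →
      ∀ u ∈ Z, ∀ v ∈ Z, ε ≤ dist u v → ∃ p ∈ F, p ∈ Z := by
  classical
  obtain ⟨n, φ, hφ, hU⟩ := hX.exists_isArcFamily
  have hunif : ∀ i, ∃ δ > 0, ∀ s t, dist s t < δ → dist (φ i s) (φ i t) < ε := fun i =>
    (Metric.uniformContinuous_iff.1
      (CompactSpace.uniformContinuous_of_continuous (hφ.continuous i)) ε hε).imp
      fun δ h => ⟨h.1, fun _ _ hst => h.2 hst⟩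
  choose δ hδ hδε using hunif
  obtain ⟨L, hL⟩ : ∃ L : ℕ, ∀ i, 1 / ((L : ℝ) + 1) < δ i := by
    choose N hN using fun i => exists_nat_one_div_lt (hδ i)
    refine ⟨∑ i, N i, fun i => lt_of_le_of_lt ?_ (hN i)⟩
    have : (N i : ℝ) ≤ (∑ i, N i : ℕ) := by
      exact_mod_cast Finset.single_le_sum (f := N) (fun _ _ => Nat.zero_le _) (Finset.mem_univ i)
    exact one_div_le_one_div_of_le (by positivity) (by linarith)
  have hL0 : (0 : ℝ) < L + 1 := by positivity
  let r : ℕ → I := fun k => projIcc 0 1 zero_le_one ((k : ℝ) / (L + 1))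
  refine ⟨Finset.univ.biUnion fun i => (Finset.range (L + 2)).image fun k => φ i (r k), ?_⟩
  intro Z hZ x hx y hy hxy
  by_contra! hF
  have hr : ∀ i, ∀ k ≤ L + 1, φ i (r k) ∉ Z := fun i k hk => hF _ (Finset.mem_biUnion.2
    ⟨i, Finset.mem_univ i, Finset.mem_image.2 ⟨k, Finset.mem_range.2 (by omega), rfl⟩⟩)
  have hrval : ∀ k ≤ L + 1, (r k : ℝ) = k / (L + 1) := by
    intro k hk
    have : (k : ℝ) ≤ L + 1 := by exact_mod_cast hk
    simp only [r]
    rw [projIcc_of_mem]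
    exact ⟨by positivity, (div_le_one hL0).2 this⟩
  have hxU : x ∈ ⋃ i, range (φ i) := hU ▸ mem_univ x
  obtain ⟨i, u, rfl⟩ := mem_iUnion.1 hxU
  set k := ⌊(u : ℝ) * (L + 1)⌋₊
  have hu0 : (0 : ℝ) ≤ u * (L + 1) := mul_nonneg u.2.1 hL0.le
  have hku : (k : ℝ) ≤ u * (L + 1) := Nat.floor_le hu0
  have huk : (u : ℝ) * (L + 1) < k + 1 := Nat.lt_floor_add_one _
  have hkL' : k ≤ L + 1 := by
    have : (k : ℝ) ≤ L + 1 := hku.trans (mul_le_of_le_one_left hL0.le u.2.2)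
    exact_mod_cast this
  have hvu : r k < u := by
    refine lt_of_le_of_ne ?_ ?_
    · rw [← Subtype.coe_le_coe, hrval k hkL', div_le_iff₀ hL0]
      exact hku
    · intro h
      exact hr i k hkL' (h ▸ hx)
  have hkL : k + 1 ≤ L + 1 := by
    have : (k : ℝ) < L + 1 := by
      have h1 : (r k : ℝ) < u := hvu
      rw [hrval k hkL', div_lt_iff₀ hL0] at h1
      exact h1.trans_le (mul_le_of_le_one_left hL0.le u.2.2)
    exact_mod_cast this
  have huw : u < r (k + 1) := by
    rw [← Subtype.coe_lt_coe, hrval _ hkL, lt_div_iff₀ hL0]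
    exact_mod_cast huk
  obtain ⟨w, hw, rfl⟩ := hφ.subset_image_Ioo hU hZ hvu huw (hr i k hkL') hx (hr i _ hkL) hy
  refine (hδε i u w ?_).not_ge hxy
  refine lt_of_lt_of_le ?_ (hL i).le
  have hw1 : (r k : ℝ) < w := hw.1
  have hw2 : (w : ℝ) < r (k + 1) := hw.2
  have hu1 : (r k : ℝ) < u := hvu
  have hu2 : (u : ℝ) < r (k + 1) := huw
  rw [hrval _ hkL, Nat.cast_add, Nat.cast_one, add_div] at hw2 hu2
  rw [hrval _ hkL'] at hw1 hu1
  rw [Subtype.dist_eq, Real.dist_eq, abs_lt]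
  constructor <;> linarith

theorem IsSubgraph.nontrivial {X : Type*} [TopologicalSpace X] {K : Set X} (hK : IsSubgraph K) :
    K.Nontrivial := by
  obtain ⟨-, ⟨⟨y, hy⟩, -⟩, hG⟩ := hK
  obtain ⟨n, φ, hφ, hU⟩ := hG.exists_isArcFamily
  have : (⟨y, hy⟩ : K) ∈ ⋃ i, range (φ i) := hU ▸ mem_univ _
  obtain ⟨i, -⟩ := mem_iUnion.1 this
  exact ⟨_, (φ i 0).2, _, (φ i 1).2, fun h => zero_ne_one (hφ.injective i (Subtype.ext h))⟩

end Graph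

section Images

variable {G : Type*} {f : G → G} {K : Set G} {P : ℕ}

theorem image_iterate_image (f : G → G) (i j : ℕ) (K : Set G) :
    f^[i] '' (f^[j] '' K) = f^[i + j] '' K := by
  rw [← image_comp, ← Function.iterate_add]

theorem image_iterate_mul_eq (hP : f^[P] '' K = K) (q : ℕ) : f^[P * q] '' K = K := by
  induction q with
  | zero => simp
  | succ q ih => rw [mul_add, mul_one, ← image_iterate_image, hP, ih]

theorem image_iterate_congr (hP : f^[P] '' K = K) {i j : ℕ} (h : i ≡ j [MOD P]) :
    f^[i] '' K = f^[j] '' K := by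
  have key : ∀ i, f^[i] '' K = f^[i % P] '' K := fun i => by
    conv_lhs => rw [← Nat.mod_add_div i P, ← image_iterate_image, image_iterate_mul_eq hP]
  rw [key i, key j, h]

theorem image_iterate_inter_nonempty {i j : ℕ} (h : (f^[i] '' K ∩ f^[j] '' K).Nonempty) (e : ℕ) :
    (f^[e + i] '' K ∩ f^[e + j] '' K).Nonempty := by
  rw [← image_iterate_image, ← image_iterate_image]
  exact (h.image f^[e]).mono (image_inter_subset _ _ _)

theorem image_iterate_subset_biUnion (h0 : 0 < P) (hP : f^[P] '' K = K) (i : ℕ) :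
    f^[i] '' K ⊆ ⋃ j ∈ Finset.range P, f^[j] '' K := by
  rw [← image_iterate_congr hP (Nat.mod_modEq i P)]
  exact subset_biUnion_of_mem (u := fun j => f^[j] '' K)
    (Finset.mem_coe.2 (Finset.mem_range.2 (Nat.mod_lt i h0)))

theorem isClosed_biUnion_image_iterate [TopologicalSpace G] [T2Space G] (hf : Continuous f)
    (hK : IsCompact K) (h0 : 0 < P) (hP : f^[P] '' K = K) (s : Set ℕ) :
    IsClosed (⋃ i ∈ s, f^[i] '' K) := by
  have hfin : ((fun i => f^[i] '' K) '' s).Finite := by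
    refine ((Finset.range P).finite_toSet.image fun i => f^[i] '' K).subset ?_
    rintro _ ⟨i, -, rfl⟩
    exact ⟨i % P, Finset.mem_coe.2 (Finset.mem_range.2 (Nat.mod_lt i h0)),
      image_iterate_congr hP (Nat.mod_modEq i P)⟩
  rw [← sUnion_image, sUnion_eq_biUnion]
  refine hfin.isClosed_biUnion ?_
  rintro _ ⟨i, -, rfl⟩
  exact (hK.image (hf.iterate i)).isClosed

theorem IsPeriodicSubgraph.modEq [TopologicalSpace G] {k : ℕ} (h : IsPeriodicSubgraph f K k)
    {i j : ℕ} (hij : (f^[i] '' K ∩ f^[j] '' K).Nonempty) : i ≡ j [MOD k] := by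
  obtain ⟨-, h0, hk, hdisj⟩ := h
  by_contra hne
  rw [← image_iterate_congr hk (Nat.mod_modEq i k), ← image_iterate_congr hk (Nat.mod_modEq j k)]
    at hij
  exact not_disjoint_iff_nonempty_inter.2 hij
    (hdisj _ _ (Nat.mod_lt i h0) (Nat.mod_lt j h0) hne)

theorem IsPeriodicSubgraph.image_iterate_mul [TopologicalSpace G] {m k : ℕ}
    (h : IsPeriodicSubgraph f^[m] K k) : f^[m * k] '' K = K := by
  rw [Function.iterate_mul]
  exact h.2.2.1

theorem IsPeriodicSubgraph.modEq_mul [TopologicalSpace G] {m k : ℕ} (hm : 0 < m)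
    (h : IsPeriodicSubgraph f^[m] K k) {i j : ℕ} (hm_ij : i ≡ j [MOD m])
    (hij : (f^[i] '' K ∩ f^[j] '' K).Nonempty) : i ≡ j [MOD m * k] := by
  have hij' := image_iterate_inter_nonempty hij (m - i % m)
  have hr : ∀ n, n % m = i % m → m - i % m + n = m * (n / m + 1) := by
    intro n hn
    have h1 := Nat.div_add_mod n m
    have h2 := Nat.mod_lt i hm
    rw [mul_add]
    omega
  rw [hr i rfl, hr j hm_ij.symm, Function.iterate_mul, Function.iterate_mul] at hij'
  have hq := Nat.ModEq.add_right_cancel' 1 (h.modEq hij')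
  have h1 := (Nat.ModEq.mul_left' m hq).add_right (i % m)
  rw [Nat.div_add_mod] at h1
  rw [hm_ij, Nat.div_add_mod] at h1
  exact h1

/-- A nondegenerate subcontinuum each of whose iterates coincides with it or is disjoint from
it is a periodic subgraph as soon as it is mapped onto itself by some iterate. -/
theorem exists_isPeriodicSubgraph [TopologicalSpace G] [T2Space G] (hG : IsTopGraph G)
    (hcl : IsClosed K) (hK : IsConnected K) (hn : K.Nontrivial) (h0 : 0 < P)
    (hP : f^[P] '' K = K) (H : ∀ i, (f^[i] '' K ∩ K).Nonempty → f^[i] '' K = K) :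
    ∃ h, 0 < h ∧ IsPeriodicSubgraph f K h := by
  classical
  have hex : ∃ h, 0 < h ∧ f^[h] '' K = K := ⟨P, h0, hP⟩
  obtain ⟨hh0, hh⟩ := Nat.find_spec hex
  set h := Nat.find hex
  refine ⟨h, hh0, hG.isSubgraph hcl hK hn, hh0, hh, ?_⟩
  have key : ∀ i j, i < j → j < h → Disjoint (f^[i] '' K) (f^[j] '' K) := by
    intro i j hij hjh
    by_contra hd
    have hne := image_iterate_inter_nonempty (not_disjoint_iff_nonempty_inter.1 hd) (h * i - i)
    have hle : i ≤ h * i := Nat.le_mul_of_pos_left i hh0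
    rw [show h * i - i + i = h * i by omega, show h * i - i + j = (j - i) + h * i by omega,
      ← image_iterate_image, image_iterate_mul_eq hh, inter_comm] at hne
    exact Nat.find_min hex (show j - i < h by omega) ⟨by omega, H _ hne⟩
  intro i j hi hj hij
  rcases lt_or_gt_of_ne hij with hlt | hlt
  · exact key i j hlt hj
  · exact (key j i hlt hi).symm

end Images

section Omega

variable {G : Type*} [TopologicalSpace G]

theorem mem_omegaSet_iff {f : G → G} {x y : G} : y ∈ omegaSet f x ↔
    ∃ U : Ultrafilter ℕ, ↑U ≤ (atTop : Filter ℕ) ∧ Tendsto (fun n => f^[n] x) U (𝓝 y) := by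
  rw [← mapClusterPt_iff_ultrafilter, mapClusterPt_iff_frequently]
  simp only [omegaSet, mem_iInter, mem_closure_iff_nhds, frequently_atTop]
  constructor
  · intro h s hs n
    obtain ⟨_, hz, m, hm, rfl⟩ := h n s hs
    exact ⟨m, hm, hz⟩
  · intro h n s hs
    obtain ⟨m, hm, hz⟩ := h s hs n
    exact ⟨_, hz, m, hm, rfl⟩

theorem omegaSet_iterate_subset {f : G → G} {m : ℕ} (hm : 0 < m) (x : G) :
    omegaSet f^[m] x ⊆ omegaSet f x := by
  intro y hy
  obtain ⟨U, hU, hy⟩ := mem_omegaSet_iff.1 hy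
  refine mem_omegaSet_iff.2 ⟨U.map (m * ·), ?_, ?_⟩
  · exact (tendsto_id.const_mul_atTop' hm).mono_left hU
  · refine tendsto_map'_iff.2 ?_
    simpa only [Function.comp_def, Function.iterate_mul] using hy

theorem omegaSet_subset_biUnion [CompactSpace G] [T2Space G] {f : G → G} (hf : Continuous f)
    {m : ℕ} (hm : 0 < m) (x : G) :
    omegaSet f x ⊆ ⋃ r ∈ Finset.range m, f^[r] '' omegaSet f^[m] x := by
  intro y hy
  obtain ⟨U, hU, hy⟩ := mem_omegaSet_iff.1 hy
  obtain ⟨r, hr, hrU⟩ : ∃ r ∈ (Finset.range m : Set ℕ), {n | n % m = r} ∈ U := by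
    rw [← Ultrafilter.finite_biUnion_mem_iff (Finset.range m).finite_toSet]
    refine Filter.univ_mem' fun n => ?_
    simp only [mem_iUnion]
    exact ⟨n % m, Finset.mem_coe.2 (Finset.mem_range.2 (Nat.mod_lt n hm)), rfl⟩
  let V := U.map (· / m)
  have hV : ↑V ≤ (atTop : Filter ℕ) := (Nat.tendsto_div_const_atTop hm.ne').mono_left hU
  let z := (V.map fun q => (f^[m])^[q] x).lim
  have hz : Tendsto (fun q => (f^[m])^[q] x) V (𝓝 z) := Ultrafilter.le_nhds_lim _
  refine mem_biUnion hr ⟨z, mem_omegaSet_iff.2 ⟨V, hV, hz⟩, ?_⟩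
  have h1 : Tendsto (fun n => f^[r] ((f^[m])^[n / m] x)) U (𝓝 (f^[r] z)) :=
    ((hf.iterate r).tendsto z).comp (tendsto_map'_iff.1 hz)
  refine tendsto_nhds_unique (h1.congr' ?_) hy
  filter_upwards [hrU] with n hn
  rw [← Function.iterate_mul, ← Function.iterate_add_apply, ← hn, Nat.mod_add_div]

theorem eventually_mem_of_omegaSet_subset [CompactSpace G] {f : G → G} {x : G}
    {O : Set G} (hO : IsOpen O) (h : omegaSet f x ⊆ O) : ∀ᶠ n in atTop, f^[n] x ∈ O := by
  by_contra hcon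
  obtain ⟨U, hU⟩ := exists_ultrafilter_iff.2 (frequently_iff_neBot.1 (not_eventually.1 hcon))
  let z := (U.map fun q => f^[q] x).lim
  have hz : Tendsto (fun q => f^[q] x) U (𝓝 z) := Ultrafilter.le_nhds_lim _
  have hzO : z ∈ O := h (mem_omegaSet_iff.2 ⟨U, hU.trans inf_le_left, hz⟩)
  have h1 : ∀ᶠ q in (U : Filter ℕ), f^[q] x ∉ O := le_principal_iff.1 (hU.trans inf_le_right)
  obtain ⟨q, hq1, hq2⟩ := (h1.and (hz.eventually (hO.mem_nhds hzO))).exists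
  exact hq1 hq2

/-- An `ω`-limit set covered by two disjoint closed forward invariant sets lies in one of them. -/
theorem omegaSet_subset_of_mapsTo [CompactSpace G] [T2Space G] {f : G → G} (hf : Continuous f)
    {x : G} {A B : Set G} (hA : IsClosed A) (hB : IsClosed B) (hAB : Disjoint A B)
    (hfA : MapsTo f A A) (hfB : MapsTo f B B) (hsub : omegaSet f x ⊆ A ∪ B)
    (hne : (omegaSet f x ∩ A).Nonempty) : omegaSet f x ⊆ A := by
  obtain ⟨U, V, hU, hV, hAU, hBV, hUV⟩ := normal_separation hA hB hAB
  have hev := eventually_mem_of_omegaSet_subset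
    (O := (U ∩ f ⁻¹' U) ∪ (V ∩ f ⁻¹' V))
    ((hU.inter (hU.preimage hf)).union (hV.inter (hV.preimage hf)))
    (hsub.trans (union_subset_union (fun a ha => ⟨hAU ha, hAU (hfA ha)⟩)
      fun b hb => ⟨hBV hb, hBV (hfB hb)⟩))
  obtain ⟨N, hN⟩ := eventually_atTop.1 hev
  obtain ⟨w, hw, hwA⟩ := hne
  obtain ⟨W, hW, hwW⟩ := mem_omegaSet_iff.1 hw
  obtain ⟨M, hM, hMU⟩ := (((eventually_ge_atTop N).filter_mono hW).and
    (hwW.eventually (hU.mem_nhds (hAU hwA)))).exists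
  have hstay : ∀ n ≥ M, f^[n] x ∈ U := by
    intro n hn
    induction n, hn using Nat.le_induction with
    | base => exact hMU
    | succ n hn ih =>
      rw [Function.iterate_succ_apply']
      rcases hN n (le_trans hM hn) with h | h
      · exact h.2
      · exact absurd h.1 (disjoint_left.1 hUV ih)
  intro y hy
  refine (hsub hy).resolve_right fun hyB => ?_
  obtain ⟨W', hW', hyW'⟩ := mem_omegaSet_iff.1 hy
  obtain ⟨n, hn, hnV⟩ := (((eventually_ge_atTop M).filter_mono hW').and
    (hyW'.eventually (hV.mem_nhds (hBV hyB)))).exists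
  exact disjoint_left.1 hUV (hstay n hn) hnV

end Omega

section Cycles

variable {G : Type*} [MetricSpace G] {f : G → G} {K : Set G} {m k : ℕ}

theorem IsPeriodicSubgraph.exists_le_dist (hf : Continuous f) (hm : 0 < m)
    (hK : IsPeriodicSubgraph f^[m] K k) (hKc : IsCompact K) :
    ∃ ε > 0, ∀ i j, Disjoint (f^[i] '' K) (f^[j] '' K) →
      ∀ u ∈ f^[i] '' K, ∀ v ∈ f^[j] '' K, ε ≤ dist u v := by
  have hP := hK.image_iterate_mul
  have h0 : 0 < m * k := Nat.mul_pos hm hK.2.1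
  have hc : ∀ i, IsCompact (f^[i] '' K) := fun i => hKc.image (hf.iterate i)
  have hloc : ∀ p : ℕ × ℕ, ∀ᶠ ε in 𝓝[>] (0 : ℝ), Disjoint (f^[p.1] '' K) (f^[p.2] '' K) →
      ∀ u ∈ f^[p.1] '' K, ∀ v ∈ f^[p.2] '' K, ε ≤ dist u v := by
    rintro ⟨i, j⟩
    by_cases hd : Disjoint (f^[i] '' K) (f^[j] '' K)
    · obtain ⟨r, hr, hruv⟩ := Metric.exists_pos_forall_lt_edist (hc i) (hc j).isClosed hd
      filter_upwards [Ioc_mem_nhdsGT (show (0 : ℝ) < r from hr)] with ε hε _ u hu v hv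
      have h := hruv u hu v hv
      rw [edist_nndist, ENNReal.coe_lt_coe] at h
      exact hε.2.trans (NNReal.coe_le_coe.2 h.le)
    · exact Eventually.of_forall fun ε h => absurd h hd
  obtain ⟨ε, hε, hε0⟩ := (((Finset.range (m * k) ×ˢ Finset.range (m * k)).eventually_all.2
    fun p _ => hloc p).and self_mem_nhdsWithin).exists
  refine ⟨ε, hε0, fun i j hij => ?_⟩
  have h := hε (i % (m * k), j % (m * k)) (Finset.mem_product.2
    ⟨Finset.mem_range.2 (Nat.mod_lt i h0), Finset.mem_range.2 (Nat.mod_lt j h0)⟩)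
  simp only [image_iterate_congr hP (Nat.mod_modEq _ _)] at h
  exact h hij

/-- Fix a cycle of graphs for `f^m`. In every cycle of graphs for `f^m` that meets its orbit and
has a sufficiently large period, two iterates can only intersect if their indices agree modulo
the period of the given cycle. -/
theorem IsPeriodicSubgraph.exists_forall_modEq (hG : IsTopGraph G) (hf : Continuous f)
    (hm : 0 < m) (hK : IsPeriodicSubgraph f^[m] K k) :
    ∃ N, ∀ (k' : ℕ) (K' : Set G), N ≤ k' → IsPeriodicSubgraph f^[m] K' k' →
      ∀ s s' w, w ∈ f^[s] '' K → w ∈ f^[s'] '' K' →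
        ∀ a b, (f^[a] '' K' ∩ f^[b] '' K').Nonempty → a ≡ b [MOD k] := by
  classical
  have : CompactSpace G := hG.1
  obtain ⟨ε, hε, hdist⟩ := hK.exists_le_dist hf hm hK.1.1.isCompact
  obtain ⟨F, hF⟩ := hG.exists_finite_separating hε
  refine ⟨F.card * (m + 1) + 1, fun k' K' hk' hK' s s' w hw hw' => ?_⟩
  have hP' := hK'.image_iterate_mul
  have h0' : 0 < m * k' := Nat.mul_pos hm hK'.2.1
  have key : ∀ a d, (f^[a] '' K' ∩ f^[a + d] '' K').Nonempty → k ∣ d := by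
    intro a d had
    by_contra hkd
    have hchain : ∀ b, (f^[b] '' K' ∩ f^[b + d] '' K').Nonempty := by
      intro b
      have h := image_iterate_inter_nonempty had (b + (m * k' - 1) * a)
      have h1 : b + (m * k' - 1) * a + a = b + m * k' * a := by
        obtain ⟨c, hc⟩ := Nat.exists_eq_succ_of_ne_zero h0'.ne'
        rw [hc, Nat.succ_eq_add_one, Nat.add_sub_cancel]
        ring
      rw [← add_assoc, h1] at h
      rwa [image_iterate_congr hP' (show b + m * k' * a ≡ b [MOD m * k'] by simp [Nat.ModEq]),
        image_iterate_congr hP' (show b + m * k' * a + d ≡ b + d [MOD m * k'] from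
          Nat.ModEq.add_right d (by simp [Nat.ModEq]))] at h
    have hmeet : ∀ t : Fin k', ∃ p : F × Fin (m + 1),
        (p.1 : G) ∈ f^[s' + m * t + p.2 * d] '' K' := by
      intro t
      let Z := ⋃ j ∈ Set.Iic m, f^[s' + m * t + j * d] '' K'
      have hZ : IsPreconnected Z := by
        refine IsPreconnected.biUnion_of_chain ordConnected_Iic (fun j _ => ?_) fun j _ _ => ?_
        · exact hK'.1.2.1.isPreconnected.image _ (hf.iterate _).continuousOn
        · have := hchain (s' + m * t + j * d)
          rwa [show s' + m * t + j * d + d = s' + m * t + Order.succ j * d by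
            rw [Nat.succ_eq_succ, Nat.succ_eq_add_one]; ring] at this
      have hshift : ∀ {i e : ℕ} {L : Set G}, w ∈ f^[i] '' L → f^[e] w ∈ f^[i + e] '' L := by
        intro i e L h
        rw [add_comm, ← image_iterate_image]
        exact mem_image_of_mem _ h
      have hd : Disjoint (f^[s + m * t] '' K) (f^[s + (m * t + m * d)] '' K) := by
        by_contra h
        have h1 := hK.modEq_mul hm (by simp [Nat.ModEq, ← add_assoc])
          (not_disjoint_iff_nonempty_inter.1 h)
        rw [← add_assoc, Nat.modEq_iff_dvd' (Nat.le_add_right _ _), Nat.add_sub_cancel_left] at h1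
        exact hkd (Nat.dvd_of_mul_dvd_mul_left hm h1)
      obtain ⟨p, hpF, hpZ⟩ := hF Z hZ (f^[m * t] w)
        (mem_biUnion (show 0 ∈ Set.Iic m from Nat.zero_le m) (by simpa using hshift hw'))
        (f^[m * t + m * d] w)
        (mem_biUnion (show m ∈ Set.Iic m from le_refl m)
          (by simpa [add_assoc] using hshift (e := m * t + m * d) hw'))
        (hdist _ _ hd _ (hshift hw) _ (hshift hw))
      obtain ⟨j, hj, hpj⟩ := mem_iUnion₂.1 hpZ
      exact ⟨(⟨p, hpF⟩, ⟨j, Nat.lt_succ_of_le hj⟩), hpj⟩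
    choose p hp using hmeet
    have hinj : Function.Injective p := by
      intro t t' htt
      have h1 := hp t
      have h2 := hp t'
      rw [← htt] at h2
      have h3 := hK'.modEq_mul hm (by simp [Nat.ModEq, Nat.add_mod]) ⟨_, h1, h2⟩
      have h4 := Nat.ModEq.add_left_cancel' s' (Nat.ModEq.add_right_cancel' _ h3)
      have h5 := Nat.ModEq.mul_left_cancel' hm.ne' h4
      exact Fin.ext (Nat.ModEq.eq_of_lt_of_lt h5 t.2 t'.2)
    have hcard := Fintype.card_le_of_injective p hinj
    simp only [Fintype.card_fin, Fintype.card_prod, Fintype.card_coe] at hcard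
    omega
  intro a b hab
  rcases le_total a b with h | h
  · rw [Nat.modEq_iff_dvd' h]
    exact key a (b - a) (by rwa [Nat.add_sub_cancel' h])
  · refine Nat.ModEq.symm ?_
    rw [Nat.modEq_iff_dvd' h]
    exact key b (a - b) (by rwa [Nat.add_sub_cancel' h, inter_comm])

/-- The connected components of the orbit of a periodic continuum form a cycle of graphs. -/
theorem exists_isPeriodicSubgraph_of_modEq (hG : IsTopGraph G) (hf : Continuous f)
    (hK : IsSubgraph K) {P : ℕ} (h0 : 0 < P) (hP : f^[P] '' K = K)
    (hmod : ∀ a b, (f^[a] '' K ∩ f^[b] '' K).Nonempty → a ≡ b [MOD k]) :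
    ∃ C h, k ≤ h ∧ IsPeriodicSubgraph f C h ∧ K ⊆ C := by
  have : CompactSpace G := hG.1
  have hclosed := isClosed_biUnion_image_iterate hf hK.1.isCompact h0 hP
  obtain ⟨p, hp⟩ := hK.2.1.nonempty
  set Y := ⋃ i ∈ (univ : Set ℕ), f^[i] '' K
  set C := connectedComponentIn Y p with hC
  have hsubY : ∀ i, f^[i] '' K ⊆ Y := fun i =>
    subset_biUnion_of_mem (u := fun i => f^[i] '' K) (mem_univ i)
  have hKY : K ⊆ Y := by simpa using hsubY 0
  have hpC : p ∈ C := mem_connectedComponentIn (hKY hp)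
  have hKC : K ⊆ C := hK.2.1.isPreconnected.subset_connectedComponentIn hp hKY
  have hmaxC : ∀ Z ⊆ Y, IsPreconnected Z → (Z ∩ C).Nonempty → Z ⊆ C := by
    rintro Z hZ hZc ⟨z, hzZ, hzC⟩
    rw [hC, connectedComponentIn_eq hzC]
    exact hZc.subset_connectedComponentIn hzZ hZ
  have hCpre : IsPreconnected C := isPreconnected_connectedComponentIn
  have hiter : ∀ i, f^[i] '' Y ⊆ Y := by
    rintro i _ ⟨y, hy, rfl⟩
    obtain ⟨j, -, hj⟩ := mem_iUnion₂.1 hy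
    refine hsubY (i + j) ?_
    rw [← image_iterate_image]
    exact mem_image_of_mem _ hj
  have hCY : C ⊆ Y := connectedComponentIn_subset Y p
  have hreturn : ∀ i, (f^[i] '' C ∩ C).Nonempty → f^[i] '' C ⊆ C := fun i hi =>
    hmaxC _ ((image_mono hCY).trans (hiter i)) (hCpre.image _ (hf.iterate i).continuousOn) hi
  have hreturn_eq : ∀ i, (f^[i] '' C ∩ C).Nonempty → f^[i] '' C = C := by
    intro i hi
    have hsub := hreturn i hi
    refine hsub.antisymm fun y hy => ?_
    obtain ⟨j, -, hj⟩ := mem_iUnion₂.1 (hCY hy)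
    have hjC : f^[j] '' K ⊆ C := hmaxC _ (hsubY j)
      (hK.2.1.isPreconnected.image _ (hf.iterate j).continuousOn) ⟨y, hj, hy⟩
    have hback : f^[(P - 1) * i + j] '' K ⊆ C := by
      rw [← image_iterate_image]
      refine (image_mono hjC).trans ?_
      rw [mul_comm, Function.iterate_mul]
      exact (mapsTo_iff_image_subset.2 hsub).iterate (P - 1) |>.image_subset
    have h1 : i + ((P - 1) * i + j) = j + P * i := by
      obtain ⟨c, rfl⟩ := Nat.exists_eq_succ_of_ne_zero h0.ne'
      rw [Nat.succ_eq_add_one, Nat.add_sub_cancel]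
      ring
    have h2 : f^[i] '' (f^[(P - 1) * i + j] '' K) = f^[j] '' K := by
      rw [image_iterate_image, h1]
      exact image_iterate_congr hP (by simp [Nat.ModEq])
    exact image_mono hback (h2.symm ▸ hj)
  have hPC : f^[P] '' C = C := hreturn_eq P
    ⟨f^[P] p, mem_image_of_mem _ hpC, hKC (hP ▸ mem_image_of_mem _ hp)⟩
  obtain ⟨h, hh0, hh⟩ := exists_isPeriodicSubgraph hG (isClosed_connectedComponentIn
    (hclosed univ) p) ⟨⟨p, hpC⟩, hCpre⟩ (hK.nontrivial.mono hKC) h0 hPC hreturn_eq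
  refine ⟨C, h, Nat.le_of_dvd hh0 ?_, hh, hKC⟩
  have hC0 : C ⊆ ⋃ i ∈ {i : ℕ | i ≡ 0 [MOD k]}, f^[i] '' K := by
    have hcover : C ⊆ (⋃ i ∈ {i : ℕ | i ≡ 0 [MOD k]}, f^[i] '' K) ∪
        ⋃ i ∈ {i : ℕ | ¬ i ≡ 0 [MOD k]}, f^[i] '' K := by
      rw [← biUnion_union]
      exact hCY.trans (biUnion_mono (fun i _ => em _) fun _ _ => Subset.rfl)
    have hdisj : Disjoint (⋃ i ∈ {i : ℕ | i ≡ 0 [MOD k]}, f^[i] '' K)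
        (⋃ i ∈ {i : ℕ | ¬ i ≡ 0 [MOD k]}, f^[i] '' K) := by
      simp only [disjoint_iUnion_left, disjoint_iUnion_right]
      intro j hj i hi
      by_contra hd
      exact hj ((hmod _ _ (not_disjoint_iff_nonempty_inter.1 hd)).symm.trans hi)
    refine (isPreconnected_iff_subset_of_disjoint_closed.1 hCpre _ _ (hclosed _) (hclosed _) hcover
      (by rw [hdisj.inter_eq, inter_empty])).resolve_right fun hsub => ?_
    exact disjoint_left.1 hdisj (mem_biUnion (show (0 : ℕ) ∈ {i : ℕ | i ≡ 0 [MOD k]} from rfl)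
      (by simpa using hp)) (hsub hpC)
  obtain ⟨i, hi, hpi⟩ := mem_iUnion₂.1 (hC0 hpC)
  have hfp : f^[h] p ∈ C := hh.2.2.1.subset <| mem_image_of_mem _ hpC
  obtain ⟨j, hj, hpj⟩ := mem_iUnion₂.1 (hC0 hfp)
  exact (Nat.modEq_zero_iff_dvd).1 ((hmod _ _ ⟨_, mem_image_of_mem _ hp, hpj⟩).trans hj)

end Cycles

section Solenoid

variable {G : Type*} [MetricSpace G] {f : G → G} {x : G} {m : ℕ}

theorem IsSolenoid.iterate (hG : IsTopGraph G) (hf : Continuous f) (hm : 0 < m)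
    (h : IsSolenoid f (omegaSet f x)) : IsSolenoid f^[m] (omegaSet f^[m] x) := by
  have : CompactSpace G := hG.1
  have hinf : (omegaSet f^[m] x).Infinite := fun hfin => h.1 <|
    ((Finset.range m).finite_toSet.biUnion fun r _ => hfin.image f^[r]).subset
      (omegaSet_subset_biUnion hf hm x)
  refine ⟨hinf, fun n => ?_⟩
  obtain ⟨X, k, hnk, ⟨K, hK, rfl⟩, hX⟩ := h.2 (m * n)
  have hP := hK.2.2.1
  have hk0 := hK.2.1
  have hclosed := isClosed_biUnion_image_iterate hf hK.1.1.isCompact hk0 hP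
  obtain ⟨w, hw⟩ := hinf.nonempty
  obtain ⟨j, -, hwj⟩ := mem_iUnion₂.1 (hX (omegaSet_iterate_subset hm x hw))
  set C := f^[j] '' K with hC
  have hiter : ∀ i, (f^[m])^[i] '' C = f^[j + m * i] '' K := fun i => by
    rw [hC, ← Function.iterate_mul, image_iterate_image, add_comm]
  have hkC : (f^[m])^[k] '' C = C := by
    rw [hiter]
    exact image_iterate_congr hP (by simp [Nat.ModEq])
  have hret : ∀ i, ((f^[m])^[i] '' C ∩ C).Nonempty → k ∣ m * i := by
    intro i hi
    rw [hiter] at hi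
    exact (Nat.modEq_zero_iff_dvd).1 (Nat.ModEq.add_left_cancel' j (hK.modEq hi))
  have hCnt : C.Nontrivial := by
    by_contra hsub
    refine not_nontrivial_iff.2 ?_ hK.1.nontrivial
    rw [not_nontrivial_iff] at hsub
    have hback : f^[k * j - j] '' C = K := by
      rw [hC, image_iterate_image, Nat.sub_add_cancel (Nat.le_mul_of_pos_left j hk0),
        image_iterate_mul_eq hP]
    exact hback ▸ hsub.image _
  obtain ⟨p, hp0, hp⟩ := exists_isPeriodicSubgraph hG
    (hK.1.1.isCompact.image (hf.iterate j)).isClosed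
    (hK.1.2.1.image _ (hf.iterate j).continuousOn) hCnt hk0 hkC (fun i hi => by
      rw [hiter]
      exact image_iterate_congr hP (by simpa using
        (Nat.modEq_zero_iff_dvd.2 (hret i hi)).add_left j))
  refine ⟨_, p, ?_, ⟨C, hp, rfl⟩, ?_⟩
  · have h1 : k ∣ m * p := hret p (by
      rw [hp.2.2.1, inter_self]
      exact hCnt.nonempty)
    exact Nat.le_of_mul_le_mul_left (hnk.trans (Nat.le_of_dvd (Nat.mul_pos hm hp0) h1)) hm
  set S : Set ℕ := {i | ∃ t, i ≡ j + m * t [MOD k]}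
  have hmaps : ∀ T : Set ℕ, (∀ i ∈ T, m + i ∈ T) →
      MapsTo f^[m] (⋃ i ∈ T, f^[i] '' K) (⋃ i ∈ T, f^[i] '' K) := by
    intro T hT y hy
    obtain ⟨i, hi, hyi⟩ := mem_iUnion₂.1 hy
    refine mem_biUnion (hT i hi) ?_
    rw [← image_iterate_image]
    exact mem_image_of_mem _ hyi
  have hsub : omegaSet f^[m] x ⊆ ⋃ i ∈ S, f^[i] '' K := by
    refine omegaSet_subset_of_mapsTo (hf.iterate m) (hclosed S) (hclosed Sᶜ) ?_ (hmaps S ?_)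
      (hmaps Sᶜ ?_) ?_ ⟨w, hw, mem_biUnion (show j ∈ S from ⟨0, by simp [Nat.ModEq]⟩) hwj⟩
    · simp only [disjoint_iUnion_left, disjoint_iUnion_right]
      rintro a ha b ⟨t, ht⟩
      by_contra hd
      exact ha ⟨t, (hK.modEq (not_disjoint_iff_nonempty_inter.1 hd)).symm.trans ht⟩
    · rintro i ⟨t, ht⟩
      exact ⟨t + 1, by simpa [mul_add, add_comm, add_left_comm] using ht.add_left m⟩
    · rintro i hi ⟨t, ht⟩
      obtain ⟨c, rfl⟩ := Nat.exists_eq_succ_of_ne_zero hk0.ne'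
      refine hi ⟨t + c, ?_⟩
      have h1 := ht.add_left (m * c)
      have h2 : m * c + (m + i) = i + (c + 1) * m := by ring
      have h3 : m * c + (j + m * t) = j + m * (t + c) := by ring
      rw [h2, h3] at h1
      exact (show i ≡ i + (c + 1) * m [MOD c + 1] by simp [Nat.ModEq]).trans h1
    · rw [← biUnion_union, union_compl_self]
      exact ((omegaSet_iterate_subset hm x).trans hX).trans
        (biUnion_mono (subset_univ _) fun _ _ => Subset.rfl)
  refine hsub.trans (iUnion₂_subset ?_)
  rintro i ⟨t, ht⟩
  rw [image_iterate_congr hP ht, ← hiter]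
  exact image_iterate_subset_biUnion hp0 hp.2.2.1 t

theorem IsSolenoid.of_iterate (hG : IsTopGraph G) (hf : Continuous f) (hm : 0 < m)
    (h : IsSolenoid f^[m] (omegaSet f^[m] x)) : IsSolenoid f (omegaSet f x) := by
  have : CompactSpace G := hG.1
  refine ⟨h.1.mono (omegaSet_iterate_subset hm x), fun n => ?_⟩
  obtain ⟨w, hw⟩ := h.1.nonempty
  obtain ⟨_, k, hnk, ⟨K, hK, rfl⟩, hX⟩ := h.2 n
  obtain ⟨N, hN⟩ := hK.exists_forall_modEq hG hf hm
  obtain ⟨_, k', hNk', ⟨K', hK', rfl⟩, hX'⟩ := h.2 N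
  have hmem : ∀ {k : ℕ} {K : Set G}, w ∈ ⋃ i ∈ Finset.range k, (f^[m])^[i] '' K →
      ∃ s, w ∈ f^[s] '' K := by
    intro k K hwK
    obtain ⟨i, -, hi⟩ := mem_iUnion₂.1 hwK
    exact ⟨m * i, by rwa [Function.iterate_mul]⟩
  obtain ⟨s, hs⟩ := hmem (hX hw)
  obtain ⟨s', hs'⟩ := hmem (hX' hw)
  obtain ⟨C, p, hkp, hC, hKC⟩ := exists_isPeriodicSubgraph_of_modEq hG hf hK'.1
    (Nat.mul_pos hm hK'.2.1) hK'.image_iterate_mul (hN k' K' hNk' hK' s s' w hs hs')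
  refine ⟨_, p, hnk.trans hkp, ⟨C, hC, rfl⟩, (omegaSet_subset_biUnion hf hm x).trans ?_⟩
  refine iUnion₂_subset fun r _ => ?_
  rintro _ ⟨y, hy, rfl⟩
  obtain ⟨i, -, hi⟩ := mem_iUnion₂.1 (hX' hy)
  refine image_iterate_subset_biUnion hC.2.1 hC.2.2.1 (r + m * i) ?_
  rw [← image_iterate_image, Function.iterate_mul]
  exact mem_image_of_mem _ (image_mono hKC hi)

end Solenoid

/-- `ω_f(x)` is a solenoid for `f` iff for every `m ≥ 1` the set `ω_{f^m}(x)` is a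
solenoid for `f^m`, iff there exists `m ≥ 1` such that `ω_{f^m}(x)` is a solenoid
for `f^m`. -/
theorem solenoid_iff_forall_pow_iff_exists_pow {G : Type*} [MetricSpace G]
    (hG : IsTopGraph G) (f : G → G) (hf : Continuous f) (x : G) :
    (IsSolenoid f (omegaSet f x) ↔
      ∀ m : ℕ, 0 < m → IsSolenoid (f^[m]) (omegaSet (f^[m]) x)) ∧
    (IsSolenoid f (omegaSet f x) ↔
      ∃ m : ℕ, 0 < m ∧ IsSolenoid (f^[m]) (omegaSet (f^[m]) x)) := by
  have hall : IsSolenoid f (omegaSet f x) →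
      ∀ m : ℕ, 0 < m → IsSolenoid (f^[m]) (omegaSet (f^[m]) x) :=
    fun h m hm => h.iterate hG hf hm
  have hex : (∃ m : ℕ, 0 < m ∧ IsSolenoid (f^[m]) (omegaSet (f^[m]) x)) →
      IsSolenoid f (omegaSet f x) :=
    fun ⟨_, hm, h⟩ => h.of_iterate hG hf hm
  exact ⟨⟨hall, fun h => hex ⟨1, one_pos, h 1 one_pos⟩⟩,
    ⟨fun h => ⟨1, one_pos, hall h 1 one_pos⟩, hex⟩⟩
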